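/- Fix an n×n complex matrix A, ε > 0, and 0 < δ₁ < δ₂, and let ψ be the cubic Hermite polynomial (ψ(x) = 0 for x < −δ₂, ψ(x) = (x+δ₂)²(2x+3δ₁−δ₂)/(δ₁−δ₂)³ for −δ₂ ≤ x ≤ −δ₁, ψ(x) = 1 for x > −δ₁). Let E(t) be a path of n×n complex matrices differentiable at t₀, and for each i = 1,…,m let λᵢ(t) ∈ ℂ, xᵢ(t), yᵢ(t) ∈ ℂⁿ be differentiable at t₀ and satisfy, for all t near t₀: (A + εE(t)) yᵢ(t) = λᵢ(t) yᵢ(t), xᵢ(t)* (A + εE(t)) = λᵢ(t) xᵢ(t)*, ‖xᵢ(t)‖ = ‖yᵢ(t)‖ = 1, and xᵢ(t)* yᵢ(t) real and strictly positive. Set ρᵢ(t) = Re λᵢ(t) and Φ(t) = (1/2) Σᵢ₌₁^m ψ(ρᵢ(t)) ((ρᵢ(t)+δ₂)₊)². Then Φ is differentiable at t₀ with Φ'(t₀) = ε · Re ⟨Γ(t₀), E'(t₀)⟩, where Γ(t) = Σᵢ₌₁^m κᵢ(t) xᵢ(t) yᵢ(t)* and κᵢ(t) = (ρᵢ(t)+δ₂)₊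 (ψ'(ρᵢ(t))(ρᵢ(t)+δ₂)₊ + 2ψ(ρᵢ(t))) / (2 xᵢ(t)* yᵢ(t)). -/

import Mathlib

open Matrix

/-- The Frobenius inner product `⟨X, Y⟩ = trace(X* Y)`. -/
noncomputable def frobInner {n : ℕ} (X Y : Matrix (Fin n) (Fin n) ℂ) : ℂ :=
  (Xᴴ * Y).trace

/-- The cubic Hermite interpolating polynomial `ψ` used in the smoothed
stabilization functional. -/
noncomputable def psi (δ₁ δ₂ x : ℝ) : ℝ :=
  if x < -δ₂ then 0
  else if x ≤ -δ₁ then (x + δ₂) ^ 2 * (2 * x + 3 * δ₁ - δ₂) / (δ₁ - δ₂) ^ 3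
  else 1

/-- The derivative of `psi`. -/
noncomputable def psi' (δ₁ δ₂ x : ℝ) : ℝ :=
  if -δ₂ ≤ x ∧ x ≤ -δ₁ then 6 * (x + δ₂) * (x + δ₁) / (δ₁ - δ₂) ^ 3 else 0

theorem hasDerivAt_ite_le {f g f' g' : ℝ → ℝ} {c : ℝ}
    (hf : ∀ x, HasDerivAt f (f' x) x) (hg : ∀ x, HasDerivAt g (g' x) x)
    (hc : f c = g c) (hc' : f' c = g' c) (x : ℝ) :
    HasDerivAt (fun x => if x ≤ c then f x else g x) (if x ≤ c then f' x else g' x) x := by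
  rcases lt_trichotomy x c with h | rfl | h
  · rw [if_pos h.le]
    refine (hf x).congr_of_eventuallyEq ?_
    filter_upwards [Iio_mem_nhds h] with z hz
    exact if_pos (le_of_lt hz)
  · rw [if_pos le_rfl, ← hasDerivWithinAt_univ, ← Set.Iic_union_Ici (a := x)]
    refine HasDerivWithinAt.union ?_ ?_
    · exact (hf x).hasDerivWithinAt.congr (fun z hz => if_pos hz) (if_pos le_rfl)
    · rw [hc']
      have hz : ∀ z ∈ Set.Ici x, (if z ≤ x then f z else g z) = g z := by
        intro z hz
        split_ifs with h
        · rw [le_antisymm h hz, hc]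
        · rfl
      exact (hg x).hasDerivWithinAt.congr hz (hz x Set.self_mem_Ici)
  · rw [if_neg h.not_ge]
    refine (hg x).congr_of_eventuallyEq ?_
    filter_upwards [Ioi_mem_nhds h] with z hz
    exact if_neg (not_le.2 hz)

theorem hasDerivAt_psi {δ₁ δ₂ : ℝ} (h : δ₁ < δ₂) (x : ℝ) :
    HasDerivAt (psi δ₁ δ₂) (psi' δ₁ δ₂ x) x := by
  have hne : δ₁ - δ₂ ≠ 0 := (sub_neg.2 h).ne
  have hcubic : ∀ x : ℝ, HasDerivAt
      (fun x => (x + δ₂) ^ 2 * (2 * x + 3 * δ₁ - δ₂) / (δ₁ - δ₂) ^ 3)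
      (6 * (x + δ₂) * (x + δ₁) / (δ₁ - δ₂) ^ 3) x := by
    intro x
    have h1 := ((hasDerivAt_id x).add_const δ₂).pow 2
    have h2 := ((((hasDerivAt_id x).const_mul 2).add_const (3 * δ₁)).sub_const δ₂)
    refine ((h1.mul h2).div_const ((δ₁ - δ₂) ^ 3)).congr_deriv ?_
    simp
    ring
  have hupper := hasDerivAt_ite_le (c := -δ₁) hcubic (fun x => hasDerivAt_const x (1 : ℝ))
    (by field_simp; ring) (by simp)
  have hall := hasDerivAt_ite_le (c := -δ₂) (fun x => hasDerivAt_const x (0 : ℝ)) hupper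
    (by rw [if_pos (by linarith)]; simp) (by rw [if_pos (by linarith)]; simp) x
  refine (hall.congr_deriv ?_).congr_of_eventuallyEq (.of_forall fun z => ?_)
  · unfold psi'
    rcases lt_trichotomy x (-δ₂) with hx | rfl | hx
    · rw [if_pos hx.le, if_neg (fun h => hx.not_ge h.1)]
    · simp
    · rw [if_neg hx.not_ge]
      simp only [hx.le, true_and]
  · simp only [psi]
    rcases lt_trichotomy z (-δ₂) with hz | rfl | hz
    · rw [if_pos hz, if_pos hz.le]
    · rw [if_neg (lt_irrefl _), if_pos (by linarith), if_pos le_rfl]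
      simp
    · rw [if_neg hz.not_gt, if_neg hz.not_ge]

theorem hasDerivAt_posPart_sq (x : ℝ) :
    HasDerivAt (fun x : ℝ => max x 0 ^ 2) (2 * max x 0) x := by
  have h := hasDerivAt_ite_le (c := 0) (f := fun _ => (0 : ℝ)) (f' := fun _ => 0)
    (g := fun x => x ^ 2) (g' := fun x => 2 * x) (fun x => hasDerivAt_const x (0 : ℝ))
    (fun x => by simpa using hasDerivAt_pow 2 x) (by simp) (by simp) x
  refine (h.congr_deriv ?_).congr_of_eventuallyEq (.of_forall fun z => ?_)
  · split_ifs with hx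
    · simp [hx]
    · rw [max_eq_left (not_le.1 hx).le]
  · dsimp only
    split_ifs with hz
    · simp [hz]
    · rw [max_eq_left (not_le.1 hz).le]

theorem hasDerivAt_psi_mul_posPart_sq {δ₁ δ₂ : ℝ} (h : δ₁ < δ₂) (x : ℝ) :
    HasDerivAt (fun x => psi δ₁ δ₂ x * max (x + δ₂) 0 ^ 2)
      (max (x + δ₂) 0 * (psi' δ₁ δ₂ x * max (x + δ₂) 0 + 2 * psi δ₁ δ₂ x)) x := by
  have hsq : HasDerivAt (fun x => max (x + δ₂) 0 ^ 2) (2 * max (x + δ₂) 0) x :=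
    (hasDerivAt_posPart_sq (x + δ₂)).comp_add_const x δ₂
  exact ((hasDerivAt_psi h x).mul hsq).congr_deriv (by ring)

theorem hasDerivAt_dotProduct_mulVec {n : ℕ} (u : Fin n → ℂ)
    {M : ℝ → Matrix (Fin n) (Fin n) ℂ} {M' : Matrix (Fin n) (Fin n) ℂ}
    {y : ℝ → Fin n → ℂ} {y' : Fin n → ℂ} {t₀ : ℝ}
    (hM : ∀ i j, HasDerivAt (fun t => M t i j) (M' i j) t₀)
    (hy : ∀ k, HasDerivAt (fun t => y t k) (y' k) t₀) :
    HasDerivAt (fun t => u ⬝ᵥ M t *ᵥ y t) (u ⬝ᵥ M' *ᵥ y t₀ + u ⬝ᵥ M t₀ *ᵥ y') t₀ := by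
  have h := HasDerivAt.fun_sum (u := Finset.univ) fun i _ =>
    (HasDerivAt.fun_sum (u := Finset.univ) fun j _ => (hM i j).fun_mul (hy j)).const_mul (u i)
  refine h.congr_deriv ?_
  simp only [dotProduct, mulVec, Finset.sum_add_distrib, mul_add]

/-- First-order perturbation of an eigenvalue, for a left eigenvector `u` of `M t₀` and right
eigenvectors `y t` of `M t`. -/
theorem eigenvalue_deriv_mul_dotProduct {n : ℕ} {u : Fin n → ℂ}
    {M : ℝ → Matrix (Fin n) (Fin n) ℂ} {M' : Matrix (Fin n) (Fin n) ℂ}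
    {y : ℝ → Fin n → ℂ} {y' : Fin n → ℂ} {μ : ℝ → ℂ} {μ' : ℂ} {t₀ : ℝ}
    (hM : ∀ i j, HasDerivAt (fun t => M t i j) (M' i j) t₀)
    (hy : ∀ k, HasDerivAt (fun t => y t k) (y' k) t₀) (hμ : HasDerivAt μ μ' t₀)
    (hright : ∀ᶠ t in nhds t₀, M t *ᵥ y t = μ t • y t)
    (hleft : u ᵥ* M t₀ = μ t₀ • u) :
    μ' * (u ⬝ᵥ y t₀) = u ⬝ᵥ M' *ᵥ y t₀ := by
  have huy : HasDerivAt (fun t => u ⬝ᵥ y t) (u ⬝ᵥ y') t₀ :=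
    HasDerivAt.fun_sum fun i _ => (hy i).const_mul (u i)
  have h := (hμ.fun_mul huy).congr_of_eventuallyEq (f₁ := fun t => u ⬝ᵥ M t *ᵥ y t) <| by
    filter_upwards [hright] with t ht
    rw [ht, dotProduct_smul, smul_eq_mul]
  have h' := h.unique (hasDerivAt_dotProduct_mulVec u hM hy)
  rw [dotProduct_mulVec u (M t₀), hleft, smul_dotProduct, smul_eq_mul] at h'
  exact add_right_cancel h'

theorem frobInner_sum_smul_vecMulVec {n m : ℕ} (c : Fin m → ℂ) (x y : Fin m → Fin n → ℂ)
    (Z : Matrix (Fin n) (Fin n) ℂ) :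
    frobInner (∑ i, c i • vecMulVec (x i) (star (y i))) Z =
      ∑ i, star (c i) * (star (x i) ⬝ᵥ Z *ᵥ y i) := by
  simp only [frobInner, conjTranspose_sum, conjTranspose_smul, conjTranspose_vecMulVec, star_star,
    Finset.sum_mul, trace_sum, smul_mul_assoc, trace_smul, smul_eq_mul, vecMulVec_mul,
    trace_vecMulVec]
  refine Finset.sum_congr rfl fun i _ => ?_
  rw [dotProduct_mulVec, dotProduct_comm]

/-- **Derivative of the smoothed stabilization functional `Φ_ε` along a matrix
path.** With `Φ(t) = (1/2) Σᵢ ψ(ρᵢ(t)) ((ρᵢ(t) + δ₂)₊)²`, `ρᵢ = Re λᵢ`, one has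
`Φ'(t₀) = ε · Re⟨Γ(t₀), E'(t₀)⟩`, where `Γ = Σᵢ κᵢ xᵢ yᵢ*` and
`κᵢ = (ρᵢ+δ₂)₊ (ψ'(ρᵢ)(ρᵢ+δ₂)₊ + 2ψ(ρᵢ)) / (2 xᵢ* yᵢ)`. -/
theorem smoothed_functional_derivative {n m : ℕ}
    (A : Matrix (Fin n) (Fin n) ℂ) (ε δ₁ δ₂ : ℝ)
    (hε : 0 < ε) (h₁ : 0 < δ₁) (h₂ : δ₁ < δ₂)
    (E : ℝ → Matrix (Fin n) (Fin n) ℂ) (E' : Matrix (Fin n) (Fin n) ℂ) (t₀ : ℝ)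
    (lam : Fin m → ℝ → ℂ) (lam' : Fin m → ℂ)
    (x y : Fin m → ℝ → Fin n → ℂ) (x' y' : Fin m → Fin n → ℂ)
    (hE : ∀ i j, HasDerivAt (fun t => E t i j) (E' i j) t₀)
    (hlam : ∀ i, HasDerivAt (lam i) (lam' i) t₀)
    (hx : ∀ i k, HasDerivAt (fun t => x i t k) (x' i k) t₀)
    (hy : ∀ i k, HasDerivAt (fun t => y i t k) (y' i k) t₀)
    (heig : ∀ᶠ t in nhds t₀, ∀ i : Fin m,
      (A + ε • E t) *ᵥ y i t = lam i t • y i t ∧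
      star (x i t) ᵥ* (A + ε • E t) = lam i t • star (x i t) ∧
      star (x i t) ⬝ᵥ x i t = 1 ∧ star (y i t) ⬝ᵥ y i t = 1 ∧
      (star (x i t) ⬝ᵥ y i t).im = 0 ∧ 0 < (star (x i t) ⬝ᵥ y i t).re) :
    HasDerivAt
      (fun t => (1 / 2 : ℝ) * ∑ i : Fin m,
        psi δ₁ δ₂ ((lam i t).re) * (max ((lam i t).re + δ₂) 0) ^ 2)
      (ε * (frobInner
        (∑ i : Fin m,
          (((max ((lam i t₀).re + δ₂) 0 *
              (psi' δ₁ δ₂ ((lam i t₀).re) * max ((lam i t₀).re + δ₂) 0 +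
                2 * psi δ₁ δ₂ ((lam i t₀).re)) : ℝ) : ℂ) /
            (2 * (star (x i t₀) ⬝ᵥ y i t₀))) •
            vecMulVec (x i t₀) (star (y i t₀)))
        E').re) t₀ := by
  have hM : ∀ i j, HasDerivAt (fun t => (A + ε • E t) i j) ((ε • E') i j) t₀ := fun i j =>
    ((hE i j).const_smul ε).const_add (A i j)
  have hlam_eq : ∀ i, lam' i * (star (x i t₀) ⬝ᵥ y i t₀) =
      ε * (star (x i t₀) ⬝ᵥ E' *ᵥ y i t₀) := by
    intro i
    rw [eigenvalue_deriv_mul_dotProduct hM (hy i) (hlam i) (heig.mono fun t ht => (ht i).1)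
      (heig.self_of_nhds i).2.1, smul_mulVec, dotProduct_smul, Complex.real_smul]
  have hre : ∀ i, HasDerivAt (fun t => (lam i t).re) (lam' i).re t₀ := fun i =>
    Complex.reCLM.hasFDerivAt.comp_hasDerivAt t₀ (hlam i)
  have hsum := (HasDerivAt.fun_sum (u := Finset.univ) fun i _ =>
    (hasDerivAt_psi_mul_posPart_sq h₂ (lam i t₀).re).comp t₀ (hre i)).const_mul (1 / 2 : ℝ)
  refine hsum.congr_deriv ?_
  rw [frobInner_sum_smul_vecMulVec, Complex.re_sum, Finset.mul_sum, Finset.mul_sum]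
  refine Finset.sum_congr rfl fun i _ => ?_
  obtain ⟨-, -, -, -, him, hpos⟩ := heig.self_of_nhds i
  generalize max ((lam i t₀).re + δ₂) 0 * (psi' δ₁ δ₂ (lam i t₀).re *
    max ((lam i t₀).re + δ₂) 0 + 2 * psi δ₁ δ₂ (lam i t₀).re) = κ
  have hi := hlam_eq i
  generalize star (x i t₀) ⬝ᵥ E' *ᵥ y i t₀ = w at hi ⊢
  obtain ⟨r, hr⟩ : ∃ r : ℝ, star (x i t₀) ⬝ᵥ y i t₀ = r := ⟨_, Complex.ext rfl (by simpa using him)⟩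
  rw [hr] at hi hpos ⊢
  have hr0 : r ≠ 0 := by simpa using hpos.ne'
  have hi' : (lam' i).re * r = ε * w.re := by simpa using congrArg Complex.re hi
  have hc : star ((κ : ℂ) / (2 * (r : ℂ))) = ((κ / (2 * r) : ℝ) : ℂ) := by
    rw [← Complex.conj_ofReal (κ / (2 * r))]
    push_cast
    rfl
  rw [hc, Complex.re_ofReal_mul]
  field_simp
  linear_combination κ * hi'
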